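/- arXiv:2412.13373 — 2 statements merged into one kernel-verified Lean document; each statement's English description precedes it below -/
import Mathlib

section
/- For every s ≥ 1 the identities R_s⁻¹ M_{⟨s⟩} M_{⟨s+1⟩} = M_{⟨s⟩} M_{⟨s+1⟩} R_s⁻¹ and R_s⁻¹ D_{⟨s+1⟩} D_{⟨s⟩} = D_{⟨s+1⟩} D_{⟨s⟩} R_s⁻¹ hold; consequently, for every p ≥ 1 and every 1 ≤ i ≤ p, the inverse Jucys–Murphy matrix J_i⁻¹ commutes with the product M_{⟨1→p⟩} D_{⟨p→1⟩}: J_i⁻¹ · M_{⟨1→p⟩} D_{⟨p→1⟩} = M_{⟨1→p⟩} D_{⟨p→1⟩} · J_i⁻¹. -/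
open scoped BigOperators

noncomputable section

/-- One-site embedding of an `N×N` matrix into `Mat_{N^k}` at 0-based position `i`
(the paper's `X_{i+1}` in 1-based numbering).  Out of range we return the identity. -/
def matAt {α : Type*} [Semiring α] (N k : ℕ) (X : Matrix (Fin N) (Fin N) α) (i : ℕ) :
    Matrix (Fin k → Fin N) (Fin k → Fin N) α :=
  if h : i < k then
    Matrix.of fun a b =>
      if ∀ l : Fin k, (l : ℕ) ≠ i → a l = b l then X (a ⟨i, h⟩) (b ⟨i, h⟩) else 0
  else 1

/-- Two-site embedding of an operator on `V⊗V` into `Mat_{N^k}` at 0-based positions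
`i, i+1` (the paper's `R_{i+1}` in 1-based numbering). -/
def opAt {α : Type*} [Semiring α] (N k : ℕ)
    (R : Matrix (Fin N × Fin N) (Fin N × Fin N) α) (i : ℕ) :
    Matrix (Fin k → Fin N) (Fin k → Fin N) α :=
  if h : i + 1 < k then
    Matrix.of fun a b =>
      if ∀ l : Fin k, (l : ℕ) ≠ i → (l : ℕ) ≠ i + 1 → a l = b l then
        R (a ⟨i, by omega⟩, a ⟨i + 1, h⟩) (b ⟨i, by omega⟩, b ⟨i + 1, h⟩)
      else 0
  else 1

/-- A numeric (complex) matrix viewed inside `Mat(A)` via the unit of `A`. -/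
def toA (A : Type*) [Semiring A] [Algebra ℂ A] {ι : Type*} (X : Matrix ι ι ℂ) :
    Matrix ι ι A :=
  X.map (algebraMap ℂ A)

/-- The braid relation `R₁R₂R₁ = R₂R₁R₂` on `V^{⊗3}`. -/
def IsBraid (N : ℕ) (R : Matrix (Fin N × Fin N) (Fin N × Fin N) ℂ) : Prop :=
  opAt N 3 R 0 * opAt N 3 R 1 * opAt N 3 R 0 = opAt N 3 R 1 * opAt N 3 R 0 * opAt N 3 R 1

/-- The Hecke condition `(q·I − R)(q⁻¹·I + R) = 0`. -/
def IsHecke (N : ℕ) (q : ℂ) (R : Matrix (Fin N × Fin N) (Fin N × Fin N) ℂ) : Prop :=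
  (q • (1 : Matrix (Fin N × Fin N) (Fin N × Fin N) ℂ) - R) * (q⁻¹ • 1 + R) = 0

/-- `q` is generic: `q ∉ {0, 1, −1}` and `qⁿ ≠ 1` for all positive integers `n`. -/
def GenericQ (q : ℂ) : Prop :=
  q ≠ 0 ∧ q ≠ 1 ∧ q ≠ -1 ∧ ∀ n : ℕ, 0 < n → q ^ n ≠ 1

/-- The reflection-equation type relation `R X₁ R X₁ = X₁ R X₁ R` in `Mat_{N²}`. -/
def RErel {α : Type*} [Semiring α] (N : ℕ)
    (R : Matrix (Fin N × Fin N) (Fin N × Fin N) α) (X : Matrix (Fin N) (Fin N) α) : Prop :=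
  opAt N 2 R 0 * matAt N 2 X 0 * opAt N 2 R 0 * matAt N 2 X 0 =
    matAt N 2 X 0 * opAt N 2 R 0 * matAt N 2 X 0 * opAt N 2 R 0

/-- The quantum-double permutation relation `D₁ R M₁ R = R M₁ R⁻¹ D₁ + R` in `Mat_{N²}(A)`. -/
def PermRel {A : Type*} [Ring A] [Algebra ℂ A] (N : ℕ)
    (R Rinv : Matrix (Fin N × Fin N) (Fin N × Fin N) ℂ)
    (M D : Matrix (Fin N) (Fin N) A) : Prop :=
  matAt N 2 D 0 * opAt N 2 (toA A R) 0 * matAt N 2 M 0 * opAt N 2 (toA A R) 0 =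
    opAt N 2 (toA A R) 0 * matAt N 2 M 0 * opAt N 2 (toA A Rinv) 0 * matAt N 2 D 0 +
      opAt N 2 (toA A R) 0

/-- The homogeneous permutation relation `D₁ R M₁ R = R M₁ R⁻¹ D₁` in `Mat_{N²}(A)`. -/
def PermRelHom {A : Type*} [Ring A] [Algebra ℂ A] (N : ℕ)
    (R Rinv : Matrix (Fin N × Fin N) (Fin N × Fin N) ℂ)
    (M D : Matrix (Fin N) (Fin N) A) : Prop :=
  matAt N 2 D 0 * opAt N 2 (toA A R) 0 * matAt N 2 M 0 * opAt N 2 (toA A R) 0 =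
    opAt N 2 (toA A R) 0 * matAt N 2 M 0 * opAt N 2 (toA A Rinv) 0 * matAt N 2 D 0

/-- Overline copies: `ovCopy … r = X_{⟨r+1⟩}`, i.e. `X_{⟨1⟩} = X⊗I⊗⋯⊗I` and
`X_{⟨r+1⟩} = R_r X_{⟨r⟩} R_r⁻¹`. -/
def ovCopy {α : Type*} [Semiring α] (N k : ℕ)
    (R Rinv : Matrix (Fin N × Fin N) (Fin N × Fin N) α)
    (X : Matrix (Fin N) (Fin N) α) : ℕ → Matrix (Fin k → Fin N) (Fin k → Fin N) α
  | 0 => matAt N k X 0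
  | r + 1 => opAt N k R r * ovCopy N k R Rinv X r * opAt N k Rinv r

/-- Underline copies: `unCopy … r = X_{[r+1]}`, i.e. `X_{[1]} = X⊗I⊗⋯⊗I` and
`X_{[r+1]} = R_r⁻¹ X_{[r]} R_r`. -/
def unCopy {α : Type*} [Semiring α] (N k : ℕ)
    (R Rinv : Matrix (Fin N × Fin N) (Fin N × Fin N) α)
    (X : Matrix (Fin N) (Fin N) α) : ℕ → Matrix (Fin k → Fin N) (Fin k → Fin N) α
  | 0 => matAt N k X 0
  | r + 1 => opAt N k Rinv r * unCopy N k R Rinv X r * opAt N k R r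

/-- `X_{⟨1→n⟩} = X_{⟨1⟩}X_{⟨2⟩}⋯X_{⟨n⟩}`. -/
def ovProd {α : Type*} [Semiring α] (N k : ℕ)
    (R Rinv : Matrix (Fin N × Fin N) (Fin N × Fin N) α)
    (X : Matrix (Fin N) (Fin N) α) (n : ℕ) : Matrix (Fin k → Fin N) (Fin k → Fin N) α :=
  ((List.range n).map (ovCopy N k R Rinv X)).prod

/-- `X_{⟨n→1⟩} = X_{⟨n⟩}X_{⟨n−1⟩}⋯X_{⟨1⟩}`. -/
def ovProdRev {α : Type*} [Semiring α] (N k : ℕ)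
    (R Rinv : Matrix (Fin N × Fin N) (Fin N × Fin N) α)
    (X : Matrix (Fin N) (Fin N) α) (n : ℕ) : Matrix (Fin k → Fin N) (Fin k → Fin N) α :=
  ((List.range n).reverse.map (ovCopy N k R Rinv X)).prod

/-- Shifted Jucys–Murphy matrices: `JMup … R n s = J_{s+1}^{↑n}`, i.e. `J₁^{↑n} = I` and
`J_{s+1}^{↑n} = R_{n+s} J_s^{↑n} R_{n+s}` (paper's 1-based `R_{n+s}` is `opAt … (n+s-1)`).
Applying it to `R⁻¹` produces `(J_{s+1}^{↑n})⁻¹`. -/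
def JMup {α : Type*} [Semiring α] (N k : ℕ)
    (R : Matrix (Fin N × Fin N) (Fin N × Fin N) α) (n : ℕ) :
    ℕ → Matrix (Fin k → Fin N) (Fin k → Fin N) α
  | 0 => 1
  | s + 1 => opAt N k R (n + s) * JMup N k R n s * opAt N k R (n + s)

/-- The quantum trace `Tr_{R(1…n)}(X) = Tr(C₁C₂⋯C_n X)`. -/
def qTr {α : Type*} [Semiring α] (N n : ℕ) (C : Matrix (Fin N) (Fin N) α)
    (X : Matrix (Fin n → Fin N) (Fin n → Fin N) α) : α :=
  Matrix.trace (((List.range n).map (matAt N n C)).prod * X)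

/-- The matrix `C`, `C_i^j = Σ_k Ψ_{ik}^{jk}`. -/
def traceMat (N : ℕ) (Ψ : Matrix (Fin N × Fin N) (Fin N × Fin N) ℂ) :
    Matrix (Fin N) (Fin N) ℂ :=
  Matrix.of fun i j => ∑ k, Ψ (i, k) (j, k)

/-- Skew-invertibility of `R`: `Tr₂(R₁₂Ψ₂₃) = Tr₂(Ψ₁₂R₂₃) = P₁₃`, written componentwise. -/
def SkewInv (N : ℕ) (R Ψ : Matrix (Fin N × Fin N) (Fin N × Fin N) ℂ) : Prop :=
  (∀ i k l n : Fin N, ∑ j, ∑ b, R (i, j) (l, b) * Ψ (b, k) (j, n) =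
      if i = n ∧ k = l then 1 else 0) ∧
  (∀ i k l n : Fin N, ∑ j, ∑ b, Ψ (i, j) (l, b) * R (b, k) (j, n) =
      if i = n ∧ k = l then 1 else 0)

/-- The generators `R₁, …, R_{n−1}` (1-based) of the Hecke-algebra image inside
`End(V^{⊗k})`, as a subset of `Mat_{N^k}`. -/
def genSet {α : Type*} [Semiring α] (N k n : ℕ)
    (R : Matrix (Fin N × Fin N) (Fin N × Fin N) α) :
    Set (Matrix (Fin k → Fin N) (Fin k → Fin N) α) :=
  {X | ∃ i : ℕ, i + 1 < n ∧ X = opAt N k R i}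

/-- The left ideal of `A` generated by the entries of `D`. -/
def entryIdeal (A : Type*) [Ring A] {N : ℕ} (D : Matrix (Fin N) (Fin N) A) :
    Submodule A A :=
  Submodule.span A {x : A | ∃ i j : Fin N, x = D i j}

/-- The normally ordered monomial `:L̂_{⟨1→k⟩}: = M_{⟨1→k⟩} D_{⟨k→1⟩} ∏_{s=1}^{k} J_s⁻¹`. -/
def normOrd {α : Type*} [Semiring α] (N k : ℕ)
    (R Rinv : Matrix (Fin N × Fin N) (Fin N × Fin N) α)
    (M D : Matrix (Fin N) (Fin N) α) (n : ℕ) :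
    Matrix (Fin k → Fin N) (Fin k → Fin N) α :=
  ovProd N k R Rinv M n * ovProdRev N k R Rinv D n *
    ((List.range n).map (fun s => JMup N k Rinv 0 s)).prod

section BraidCopies

theorem SemiconjBy.commute_map {S : Type*} [Monoid S] {g : Sˣ} {a a' z z' : S}
    (ha : SemiconjBy (g : S) a a') (hz : SemiconjBy (g : S) z z') (h : Commute a z) :
    Commute a' z' := by
  have h₁ : SemiconjBy (g : S) (a * z) (a' * z') := ha.mul_right hz
  have h₂ : SemiconjBy (g : S) (a * z) (z' * a') := by
    rw [h.eq]
    exact hz.mul_right ha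
  exact (Units.mul_left_inj g).1 (h₁.eq.symm.trans h₂.eq)

/-- Successive conjugates `x, u₀ x u₀⁻¹, u₁ u₀ x u₀⁻¹ u₁⁻¹, …`. -/
def conjCopy {S : Type*} [Monoid S] (u : ℕ → Sˣ) (x : S) : ℕ → S
  | 0 => x
  | r + 1 => u r * conjCopy u x r * ↑(u r)⁻¹

variable {S : Type*} [Monoid S] {u : ℕ → Sˣ} {x : S} {t : ℕ}

theorem semiconjBy_conjCopy (u : ℕ → Sˣ) (x : S) (j : ℕ) :
    SemiconjBy (u j : S) (conjCopy u x j) (conjCopy u x (j + 1)) := by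
  simp [SemiconjBy, conjCopy, mul_assoc]

theorem commute_conjCopy_of_lt (hfar : ∀ i j, i + 1 < j → Commute (u i : S) (u j))
    (hx : ∀ j, 1 ≤ j → Commute (u j : S) x) {j k : ℕ} (hk : k < j) :
    Commute (u j : S) (conjCopy u x k) := by
  induction k with
  | zero => exact hx j hk
  | succ k ih =>
    have h := (hfar k j hk).symm
    exact (h.mul_right (ih (by omega))).mul_right h.units_inv_right

theorem commute_conjCopy_of_gt (hfar : ∀ i j, i + 1 < j → Commute (u i : S) (u j))
    (hbraid : ∀ j, j + 2 < t → u j * u (j + 1) * u j = u (j + 1) * u j * u (j + 1))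
    (hx : ∀ j, 1 ≤ j → Commute (u j : S) x) {j k : ℕ} (hk : j + 2 ≤ k) (hkt : k < t) :
    Commute (u j : S) (conjCopy u x k) := by
  induction k, hk using Nat.le_induction with
  | base =>
    have h₁ : SemiconjBy ((u (j + 1) * u j : Sˣ) : S) (u (j + 1)) (u j) := by
      have := congrArg Units.val (hbraid j hkt)
      simp only [Units.val_mul] at this
      simp only [SemiconjBy, Units.val_mul]
      rw [← this, mul_assoc]
    have h₂ : SemiconjBy ((u (j + 1) * u j : Sˣ) : S) (conjCopy u x j)
        (conjCopy u x (j + 2)) := by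
      rw [Units.val_mul]
      exact (semiconjBy_conjCopy u x (j + 1)).mul_left (semiconjBy_conjCopy u x j)
    exact h₁.commute_map h₂ (commute_conjCopy_of_lt hfar hx (Nat.lt_succ_self j))
  | succ k hk ih =>
    have h := hfar j k (by omega)
    exact (h.mul_right (ih (by omega))).mul_right h.units_inv_right

theorem semiconjBy_mul_conjCopy (hfar : ∀ i j, i + 1 < j → Commute (u i : S) (u j))
    (hbraid : ∀ j, j + 2 < t → u j * u (j + 1) * u j = u (j + 1) * u j * u (j + 1))
    (hx : ∀ j, 1 ≤ j → Commute (u j : S) x) {j : ℕ} (hj : j + 2 < t) :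
    SemiconjBy ((u j * u (j + 1) : Sˣ) : S) (u j) (u (j + 1)) ∧
    SemiconjBy ((u j * u (j + 1) : Sˣ) : S) (conjCopy u x j) (conjCopy u x (j + 1)) ∧
    SemiconjBy ((u j * u (j + 1) : Sˣ) : S) (conjCopy u x (j + 1)) (conjCopy u x (j + 2)) := by
  simp only [Units.val_mul]
  refine ⟨?_, ?_, ?_⟩
  · have := congrArg Units.val (hbraid j hj)
    simp only [Units.val_mul] at this
    simp only [SemiconjBy]
    rw [this, mul_assoc]
  · exact (semiconjBy_conjCopy u x j).mul_left
      (commute_conjCopy_of_lt hfar hx (Nat.lt_succ_self j))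
  · exact SemiconjBy.mul_left (commute_conjCopy_of_gt hfar hbraid hx le_rfl hj)
      (semiconjBy_conjCopy u x (j + 1))

theorem commute_conjCopy_mul_succ (hfar : ∀ i j, i + 1 < j → Commute (u i : S) (u j))
    (hbraid : ∀ j, j + 2 < t → u j * u (j + 1) * u j = u (j + 1) * u j * u (j + 1))
    (hx : ∀ j, 1 ≤ j → Commute (u j : S) x)
    (h0 : 1 < t → (u 0 * x * u 0 * x : S) = x * u 0 * x * u 0)
    {j : ℕ} (hj : j + 1 < t) :
    Commute (u j : S) (conjCopy u x j * conjCopy u x (j + 1)) := by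
  induction j with
  | zero =>
    have := h0 hj
    simp only [Commute, SemiconjBy, conjCopy, mul_assoc, Units.inv_mul, mul_one] at this ⊢
    simp only [← mul_assoc] at this ⊢
    rw [this]
    simp [mul_assoc]
  | succ j ih =>
    obtain ⟨h₁, h₂, h₃⟩ := semiconjBy_mul_conjCopy hfar hbraid hx hj
    exact h₁.commute_map (h₂.mul_right h₃) (ih (by omega))

theorem commute_conjCopy_succ_mul (hfar : ∀ i j, i + 1 < j → Commute (u i : S) (u j))
    (hbraid : ∀ j, j + 2 < t → u j * u (j + 1) * u j = u (j + 1) * u j * u (j + 1))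
    (hx : ∀ j, 1 ≤ j → Commute (u j : S) x)
    (h0 : 1 < t → (↑(u 0)⁻¹ * x * ↑(u 0)⁻¹ * x : S) = x * ↑(u 0)⁻¹ * x * ↑(u 0)⁻¹)
    {j : ℕ} (hj : j + 1 < t) :
    Commute (u j : S) (conjCopy u x (j + 1) * conjCopy u x j) := by
  induction j with
  | zero =>
    have h := h0 hj
    calc (u 0 : S) * (u 0 * x * ↑(u 0)⁻¹ * x)
        = u 0 * u 0 * (x * ↑(u 0)⁻¹ * x * ↑(u 0)⁻¹) * u 0 := by simp [mul_assoc]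
      _ = u 0 * u 0 * (↑(u 0)⁻¹ * x * ↑(u 0)⁻¹ * x) * u 0 := by rw [h]
      _ = u 0 * x * ↑(u 0)⁻¹ * x * u 0 := by simp [mul_assoc]
  | succ j ih =>
    obtain ⟨h₁, h₂, h₃⟩ := semiconjBy_mul_conjCopy hfar hbraid hx hj
    exact h₁.commute_map (h₃.mul_right h₂) (ih (by omega))

theorem commute_prod_conjCopy (hfar : ∀ i j, i + 1 < j → Commute (u i : S) (u j))
    (hbraid : ∀ j, j + 2 < t → u j * u (j + 1) * u j = u (j + 1) * u j * u (j + 1))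
    (hx : ∀ j, 1 ≤ j → Commute (u j : S) x)
    (h0 : 1 < t → (u 0 * x * u 0 * x : S) = x * u 0 * x * u 0)
    {j p : ℕ} (hj : j + 2 ≤ p) (hp : p ≤ t) :
    Commute (u j : S) ((List.range p).map (conjCopy u x)).prod := by
  induction p, hj using Nat.le_induction with
  | base =>
    simp only [List.range_succ, List.map_append, List.prod_append, List.map_cons, List.map_nil,
      List.prod_singleton, mul_assoc]
    refine Commute.mul_right (Commute.list_prod_right _ _ ?_)
      (commute_conjCopy_mul_succ hfar hbraid hx h0 hp)
    simp only [List.mem_map, List.mem_range, forall_exists_index, and_imp,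
      forall_apply_eq_imp_iff₂]
    exact fun k hk => commute_conjCopy_of_lt hfar hx hk
  | succ p hj ih =>
    simp only [List.range_succ, List.map_append, List.prod_append, List.map_cons, List.map_nil,
      List.prod_singleton]
    exact (ih (by omega)).mul_right (commute_conjCopy_of_gt hfar hbraid hx hj hp)

theorem commute_prod_reverse_conjCopy (hfar : ∀ i j, i + 1 < j → Commute (u i : S) (u j))
    (hbraid : ∀ j, j + 2 < t → u j * u (j + 1) * u j = u (j + 1) * u j * u (j + 1))
    (hx : ∀ j, 1 ≤ j → Commute (u j : S) x)
    (h0 : 1 < t → (↑(u 0)⁻¹ * x * ↑(u 0)⁻¹ * x : S) = x * ↑(u 0)⁻¹ * x * ↑(u 0)⁻¹)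
    {j p : ℕ} (hj : j + 2 ≤ p) (hp : p ≤ t) :
    Commute (u j : S) ((List.range p).reverse.map (conjCopy u x)).prod := by
  induction p, hj using Nat.le_induction with
  | base =>
    simp only [List.range_succ, List.reverse_append, List.reverse_singleton,
      List.singleton_append, List.map_cons, List.prod_cons, ← mul_assoc]
    refine Commute.mul_right (commute_conjCopy_succ_mul hfar hbraid hx h0 hp)
      (Commute.list_prod_right _ _ ?_)
    simp only [List.mem_map, List.mem_reverse, List.mem_range, forall_exists_index, and_imp,
      forall_apply_eq_imp_iff₂]
    exact fun k hk => commute_conjCopy_of_lt hfar hx hk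
  | succ p hj ih =>
    simp only [List.range_succ, List.reverse_append, List.reverse_singleton,
      List.singleton_append, List.map_cons, List.prod_cons]
    exact (commute_conjCopy_of_gt hfar hbraid hx hj hp).mul_right (ih (by omega))

end BraidCopies

section SiteEmbedding

variable {α : Type*} [Semiring α] {N m k t : ℕ}

/-- The operator on the tensor factors listed by `e`, acting as the identity on the others. -/
def siteEmb (e : Fin m → Fin t) (X : Matrix (Fin m → Fin N) (Fin m → Fin N) α) :
    Matrix (Fin t → Fin N) (Fin t → Fin N) α :=
  Matrix.of fun a b => if ∀ l, (∀ i, e i ≠ l) → a l = b l then X (a ∘ e) (b ∘ e) else 0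

theorem siteEmb_one {e : Fin m → Fin t} :
    siteEmb e (1 : Matrix (Fin m → Fin N) (Fin m → Fin N) α) = 1 := by
  ext a b
  by_cases h : a = b
  · subst h
    simp [siteEmb]
  · have : ¬ ((∀ l, (∀ i, e i ≠ l) → a l = b l) ∧ a ∘ e = b ∘ e) := by
      rintro ⟨h₁, h₂⟩
      refine h (funext fun l => ?_)
      by_cases hl : ∃ i, e i = l
      · obtain ⟨i, rfl⟩ := hl
        exact congrFun h₂ i
      · exact h₁ l (by simpa using hl)
    simp only [siteEmb, Matrix.of_apply, Matrix.one_apply, h, if_false]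
    split_ifs <;> tauto

theorem siteEmb_mul {e : Fin m → Fin t} (he : Function.Injective e)
    (X Y : Matrix (Fin m → Fin N) (Fin m → Fin N) α) :
    siteEmb e (X * Y) = siteEmb e X * siteEmb e Y := by
  ext a b
  have hoff : ∀ (d : Fin m → Fin N) l, (∀ i, e i ≠ l) → Function.extend e d a l = a l :=
    fun d l hl => Function.extend_apply' _ _ _ (by simpa using hl)
  simp only [Matrix.mul_apply, siteEmb, Matrix.of_apply]
  rw [← Fintype.sum_of_injective (fun d => Function.extend e d a)
    (f := fun d => if ∀ l, (∀ i, e i ≠ l) → a l = b l then X (a ∘ e) d * Y d (b ∘ e) else 0)]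
  · split_ifs <;> simp
  · exact Function.extend_injective he a
  · intro c hc
    rw [if_neg, zero_mul]
    intro h
    refine hc ⟨c ∘ e, funext fun l => ?_⟩
    by_cases hl : ∃ i, e i = l
    · obtain ⟨i, rfl⟩ := hl
      simp [he.extend_apply]
    · have hl' : ∀ i, e i ≠ l := by simpa using hl
      simp only [hoff _ l hl', h l hl']
  · intro d
    have h₁ : Function.extend e d a ∘ e = d := Function.extend_comp he d a
    have h₂ : (∀ l, (∀ i, e i ≠ l) → Function.extend e d a l = b l) ↔
        ∀ l, (∀ i, e i ≠ l) → a l = b l :=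
      forall₂_congr fun l hl => by rw [hoff d l hl]
    rw [if_pos fun l hl => (hoff d l hl).symm, h₁]
    simp only [h₂, mul_ite, mul_zero]

theorem siteEmb_mul_of_disjoint {e : Fin m → Fin t} {f : Fin k → Fin t}
    (hef : ∀ i j, e i ≠ f j) (X : Matrix (Fin m → Fin N) (Fin m → Fin N) α)
    (Y : Matrix (Fin k → Fin N) (Fin k → Fin N) α) (a b : Fin t → Fin N) :
    (siteEmb e X * siteEmb f Y) a b =
      if ∀ l, (∀ i, e i ≠ l) → (∀ i, f i ≠ l) → a l = b l then
        X (a ∘ e) (b ∘ e) * Y (a ∘ f) (b ∘ f) else 0 := by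
  simp only [Matrix.mul_apply, siteEmb, Matrix.of_apply]
  rw [Fintype.sum_eq_single (fun l => if ∀ i, e i ≠ l then a l else b l)]
  · have h₁ : (fun l => if ∀ i, e i ≠ l then a l else b l) ∘ e = b ∘ e := by
      funext i; simp
    have h₂ : (fun l => if ∀ i, e i ≠ l then a l else b l) ∘ f = a ∘ f := by
      funext i; simp [hef]
    rw [h₁, h₂, if_pos fun l hl => (if_pos hl).symm]
    have h₃ : (∀ l, (∀ i, f i ≠ l) → (if ∀ i, e i ≠ l then a l else b l) = b l) ↔
        ∀ l, (∀ i, e i ≠ l) → (∀ i, f i ≠ l) → a l = b l := by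
      refine forall_congr' fun l => ?_
      by_cases h : ∀ i, e i ≠ l
      · simp only [if_pos h]; tauto
      · simp only [if_neg h]; tauto
    simp only [h₃, mul_ite, mul_zero]
  · intro c hc
    by_cases h₁ : ∀ l, (∀ i, e i ≠ l) → a l = c l
    · rw [if_neg (c := ∀ l, (∀ i, f i ≠ l) → c l = b l), mul_zero]
      intro h₂
      refine hc (funext fun l => ?_)
      split_ifs with h
      · exact (h₁ l h).symm
      · obtain ⟨i, rfl⟩ := not_forall_not.1 h
        exact h₂ _ fun j => (hef i j).symm
    · rw [if_neg h₁, zero_mul]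

theorem commute_siteEmb {e : Fin m → Fin t} {f : Fin k → Fin t}
    (hef : ∀ i j, e i ≠ f j) {X : Matrix (Fin m → Fin N) (Fin m → Fin N) α}
    {Y : Matrix (Fin k → Fin N) (Fin k → Fin N) α}
    (hXY : ∀ a b c d, Commute (X a b) (Y c d)) : Commute (siteEmb e X) (siteEmb f Y) := by
  ext a b
  rw [siteEmb_mul_of_disjoint hef, siteEmb_mul_of_disjoint fun i j => (hef j i).symm]
  have : (∀ l, (∀ i, e i ≠ l) → (∀ i, f i ≠ l) → a l = b l) ↔
      ∀ l, (∀ i, f i ≠ l) → (∀ i, e i ≠ l) → a l = b l := by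
    refine forall_congr' fun l => ?_
    tauto
  simp only [this, (hXY _ _ _ _).eq]

/-- The block of `k` consecutive sites starting at `j`. -/
def siteBlock {j : ℕ} (h : j + k ≤ t) (i : Fin k) : Fin t := ⟨j + i, by omega⟩

theorem siteBlock_injective {j : ℕ} (h : j + k ≤ t) : Function.Injective (siteBlock h) := by
  intro a b hab
  simp only [siteBlock, Fin.mk.injEq] at hab
  exact Fin.ext (by omega)

theorem forall_siteBlock {j : ℕ} (h : j + k ≤ t) (P : ℕ → Prop) (Q : Fin t → Prop)
    (hP : ∀ n, P n → j ≤ n ∧ n < j + k) :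
    (∀ l : Fin t, ¬ P l → Q l) ↔
      (∀ l, (∀ i, siteBlock h i ≠ l) → Q l) ∧ ∀ l : Fin k, ¬ P (j + l) → Q (siteBlock h l) := by
  refine ⟨fun H => ⟨fun l hl => H l fun hl' => ?_, fun l hl => H _ hl⟩, fun ⟨H₁, H₂⟩ l hl => ?_⟩
  · obtain ⟨h₁, h₂⟩ := hP _ hl'
    exact hl ⟨l - j, by omega⟩ (Fin.ext (by simp only [siteBlock]; omega))
  · by_cases hr : ∃ i, siteBlock h i = l
    · obtain ⟨i, rfl⟩ := hr
      exact H₂ i hl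
    · exact H₁ l (by simpa using hr)

theorem opAt_eq_siteEmb (R : Matrix (Fin N × Fin N) (Fin N × Fin N) α) {j d : ℕ}
    (h : j + k ≤ t) (hd : d + 1 < k) :
    opAt N t R (j + d) = siteEmb (siteBlock h) (opAt N k R d) := by
  ext a b
  have H := forall_siteBlock h (fun n => n = j + d ∨ n = j + d + 1) (fun l => a l = b l)
    (fun n hn => by omega)
  simp only [not_or, and_imp, Nat.add_left_cancel_iff, add_assoc j d 1] at H
  simp only [← add_assoc] at H
  simp only [opAt, siteEmb, dif_pos hd, dif_pos (show j + d + 1 < t by omega), Matrix.of_apply,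
    ne_eq] at H ⊢
  rw [ite_cond_congr (propext H), ite_and]
  rfl

theorem matAt_eq_siteEmb (X : Matrix (Fin N) (Fin N) α) {j d : ℕ}
    (h : j + k ≤ t) (hd : d < k) :
    matAt N t X (j + d) = siteEmb (siteBlock h) (matAt N k X d) := by
  ext a b
  have H := forall_siteBlock h (fun n => n = j + d) (fun l => a l = b l) (fun n hn => by omega)
  simp only [Nat.add_left_cancel_iff] at H
  simp only [matAt, siteEmb, dif_pos hd, dif_pos (show j + d < t by omega), Matrix.of_apply,
    ne_eq] at H ⊢
  simp only [H, ite_and]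
  rfl

theorem opAt_of_le (R : Matrix (Fin N × Fin N) (Fin N × Fin N) α) {i : ℕ} (h : t ≤ i + 1) :
    opAt N t R i = 1 := dif_neg (by omega)

theorem opAt_two (R : Matrix (Fin N × Fin N) (Fin N × Fin N) α) :
    opAt N 2 R 0 = R.submatrix (finTwoArrowEquiv (Fin N)) (finTwoArrowEquiv (Fin N)) := by
  ext a b
  simp [opAt, Fin.forall_fin_two]

theorem opAt_mul_opAt {R S : Matrix (Fin N × Fin N) (Fin N × Fin N) α} (h : R * S = 1) (i : ℕ) :
    opAt N t R i * opAt N t S i = 1 := by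
  by_cases hi : i + 2 ≤ t
  · have H := fun T => opAt_eq_siteEmb (N := N) (α := α) T (d := 0) hi one_lt_two
    simp only [add_zero] at H
    rw [H, H, ← siteEmb_mul (siteBlock_injective hi), opAt_two, opAt_two,
      Matrix.submatrix_mul_equiv, h, Matrix.submatrix_one_equiv, siteEmb_one]
  · simp [opAt_of_le (N := N) (α := α) (t := t) _ (show t ≤ i + 1 by omega)]

theorem commute_opAt {R S : Matrix (Fin N × Fin N) (Fin N × Fin N) α}
    (hRS : ∀ a b c d, Commute (R a b) (S c d)) {i j : ℕ} (hij : i + 1 < j) :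
    Commute (opAt N t R i) (opAt N t S j) := by
  by_cases hj : j + 2 ≤ t
  · have hi : i + 2 ≤ t := by omega
    have h₁ := opAt_eq_siteEmb R (d := 0) hi one_lt_two
    have h₂ := opAt_eq_siteEmb S (d := 0) hj one_lt_two
    rw [add_zero] at h₁ h₂
    rw [h₁, h₂, opAt_two, opAt_two]
    refine commute_siteEmb (fun a b => ?_) fun a b c d => hRS _ _ _ _
    simp only [siteBlock, ne_eq, Fin.mk.injEq]
    omega
  · rw [opAt_of_le S (by omega)]
    exact Commute.one_right _

theorem commute_opAt_matAt {R : Matrix (Fin N × Fin N) (Fin N × Fin N) α}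
    {X : Matrix (Fin N) (Fin N) α} (hRX : ∀ a b c d, Commute (R a b) (X c d)) {i j : ℕ}
    (hij : i < j) : Commute (opAt N t R j) (matAt N t X i) := by
  by_cases hj : j + 2 ≤ t
  · have hi : i + 1 ≤ t := by omega
    have h₁ := opAt_eq_siteEmb R (d := 0) hj one_lt_two
    have h₂ := matAt_eq_siteEmb X (d := 0) hi one_pos
    rw [add_zero] at h₁ h₂
    rw [h₁, h₂, opAt_two]
    refine commute_siteEmb (fun a b => ?_) fun a b c d => ?_
    · simp only [siteBlock, ne_eq, Fin.mk.injEq]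
      omega
    · simpa [matAt] using hRX _ _ _ _
  · rw [opAt_of_le R (by omega)]
    exact Commute.one_left _

theorem opAt_braid {R : Matrix (Fin N × Fin N) (Fin N × Fin N) α}
    (h : opAt N 3 R 0 * opAt N 3 R 1 * opAt N 3 R 0 =
      opAt N 3 R 1 * opAt N 3 R 0 * opAt N 3 R 1) {j : ℕ} (hj : j + 2 < t) :
    opAt N t R j * opAt N t R (j + 1) * opAt N t R j =
      opAt N t R (j + 1) * opAt N t R j * opAt N t R (j + 1) := by
  have hj' : j + 3 ≤ t := hj
  have h₁ := opAt_eq_siteEmb R (d := 0) hj' (by norm_num)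
  have h₂ := opAt_eq_siteEmb R (d := 1) hj' (by norm_num)
  rw [add_zero] at h₁
  simp only [h₁, h₂, ← siteEmb_mul (siteBlock_injective hj'), h]

theorem RErel.opAt_matAt {R : Matrix (Fin N × Fin N) (Fin N × Fin N) α}
    {X : Matrix (Fin N) (Fin N) α} (h : RErel N R X) (ht : 1 < t) :
    opAt N t R 0 * matAt N t X 0 * opAt N t R 0 * matAt N t X 0 =
      matAt N t X 0 * opAt N t R 0 * matAt N t X 0 * opAt N t R 0 := by
  have ht' : 0 + 2 ≤ t := by omega
  have h₁ := opAt_eq_siteEmb R (d := 0) ht' one_lt_two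
  have h₂ := matAt_eq_siteEmb X (d := 0) ht' two_pos
  rw [add_zero] at h₁ h₂
  rw [RErel] at h
  simp only [h₁, h₂, ← siteEmb_mul (siteBlock_injective ht'), h]

end SiteEmbedding

theorem toA_opAt (A : Type*) [Semiring A] [Algebra ℂ A] {N k : ℕ}
    (R : Matrix (Fin N × Fin N) (Fin N × Fin N) ℂ) (i : ℕ) :
    toA A (opAt N k R i) = opAt N k (toA A R) i := by
  ext a b
  by_cases h : i + 1 < k
  · simp only [toA, opAt, dif_pos h, Matrix.map_apply, Matrix.of_apply, apply_ite (algebraMap ℂ A),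
      map_zero]
  · simp [toA, opAt, dif_neg h, Matrix.one_apply, apply_ite (algebraMap ℂ A)]

theorem toA_mul (A : Type*) [Semiring A] [Algebra ℂ A] {ι : Type*} [Fintype ι]
    (X Y : Matrix ι ι ℂ) : toA A (X * Y) = toA A X * toA A Y :=
  Matrix.map_mul

theorem toA_one (A : Type*) [Semiring A] [Algebra ℂ A] {ι : Type*} [DecidableEq ι] :
    toA A (1 : Matrix ι ι ℂ) = 1 :=
  Matrix.map_one _ (map_zero _) (map_one _)

/-- `opAt` of an invertible matrix, as a unit. -/
def opAtUnit {α : Type*} [Semiring α] {N : ℕ} (t : ℕ)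
    {R S : Matrix (Fin N × Fin N) (Fin N × Fin N) α} (h : R * S = 1 ∧ S * R = 1) (i : ℕ) :
    (Matrix (Fin t → Fin N) (Fin t → Fin N) α)ˣ :=
  ⟨opAt N t R i, opAt N t S i, opAt_mul_opAt h.1 i, opAt_mul_opAt h.2 i⟩

theorem conjCopy_opAtUnit {α : Type*} [Semiring α] {N : ℕ} (t : ℕ)
    {R S : Matrix (Fin N × Fin N) (Fin N × Fin N) α} (h : R * S = 1 ∧ S * R = 1)
    (X : Matrix (Fin N) (Fin N) α) (r : ℕ) :
    conjCopy (opAtUnit t h) (matAt N t X 0) r = ovCopy N t R S X r := by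
  induction r with
  | zero => rfl
  | succ r ih => simp only [conjCopy, ovCopy, ih]; rfl

theorem commute_JMup {α : Type*} [Semiring α] {N k : ℕ}
    {R : Matrix (Fin N × Fin N) (Fin N × Fin N) α} {n s : ℕ}
    {Z : Matrix (Fin k → Fin N) (Fin k → Fin N) α}
    (h : ∀ j, j < s → Commute (opAt N k R (n + j)) Z) : Commute (JMup N k R n s) Z := by
  induction s with
  | zero => exact Commute.one_left _
  | succ s ih =>
    have hs := h s (Nat.lt_succ_self s)
    exact (hs.mul_left (ih fun j hj => h j (by omega))).mul_left hs

/-- `R_s⁻¹ M_{⟨s⟩} M_{⟨s+1⟩} = M_{⟨s⟩} M_{⟨s+1⟩} R_s⁻¹` and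
`R_s⁻¹ D_{⟨s+1⟩} D_{⟨s⟩} = D_{⟨s+1⟩} D_{⟨s⟩} R_s⁻¹` for every `s ≥ 1`; consequently
`J_i⁻¹` commutes with `M_{⟨1→p⟩} D_{⟨p→1⟩}` for every `1 ≤ i ≤ p`. -/
theorem stmt14 {A : Type*} [Ring A] [Algebra ℂ A] (N : ℕ) (hN : 1 ≤ N) (q : ℂ)
    (hq : GenericQ q)
    (R Rinv : Matrix (Fin N × Fin N) (Fin N × Fin N) ℂ)
    (hRinv : R * Rinv = 1 ∧ Rinv * R = 1)
    (hbraid : IsBraid N R) (hHecke : IsHecke N q R)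
    (M D : Matrix (Fin N) (Fin N) A)
    (hM : RErel N (toA A R) M)
    (hD : RErel N (toA A Rinv) D) :
    (∀ s t : ℕ, 1 ≤ s → s + 1 ≤ t →
      opAt N t (toA A Rinv) (s - 1) * (ovCopy N t (toA A R) (toA A Rinv) M (s - 1) *
          ovCopy N t (toA A R) (toA A Rinv) M s) =
        ovCopy N t (toA A R) (toA A Rinv) M (s - 1) *
          ovCopy N t (toA A R) (toA A Rinv) M s * opAt N t (toA A Rinv) (s - 1)) ∧
    (∀ s t : ℕ, 1 ≤ s → s + 1 ≤ t →
      opAt N t (toA A Rinv) (s - 1) * (ovCopy N t (toA A R) (toA A Rinv) D s *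
          ovCopy N t (toA A R) (toA A Rinv) D (s - 1)) =
        ovCopy N t (toA A R) (toA A Rinv) D s *
          ovCopy N t (toA A R) (toA A Rinv) D (s - 1) * opAt N t (toA A Rinv) (s - 1)) ∧
    (∀ p t i : ℕ, 1 ≤ p → p ≤ t → 1 ≤ i → i ≤ p →
      JMup N t (toA A Rinv) 0 (i - 1) *
          (ovProd N t (toA A R) (toA A Rinv) M p * ovProdRev N t (toA A R) (toA A Rinv) D p) =
        (ovProd N t (toA A R) (toA A Rinv) M p * ovProdRev N t (toA A R) (toA A Rinv) D p) *
          JMup N t (toA A Rinv) 0 (i - 1)) := by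
  have hinv : toA A R * toA A Rinv = 1 ∧ toA A Rinv * toA A R = 1 := by
    simp only [← toA_mul, hRinv.1, hRinv.2, toA_one, and_self]
  have hcomm : ∀ a b (x : A), Commute (toA A R a b) x := fun a b x => Algebra.commutes _ _
  have hbr : opAt N 3 (toA A R) 0 * opAt N 3 (toA A R) 1 * opAt N 3 (toA A R) 0 =
      opAt N 3 (toA A R) 1 * opAt N 3 (toA A R) 0 * opAt N 3 (toA A R) 1 := by
    simp only [← toA_opAt, ← toA_mul]
    exact congrArg (toA A) hbraid
  have hfar : ∀ t i j, i + 1 < j →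
      Commute (opAtUnit t hinv i : Matrix (Fin t → Fin N) (Fin t → Fin N) A)
        (opAtUnit t hinv j) :=
    fun t i j hij => commute_opAt (R := toA A R) (S := toA A R) (fun a b _ _ => hcomm a b _) hij
  have hbraidA : ∀ t j, j + 2 < t →
      opAtUnit t hinv j * opAtUnit t hinv (j + 1) * opAtUnit t hinv j =
        opAtUnit t hinv (j + 1) * opAtUnit t hinv j * opAtUnit t hinv (j + 1) :=
    fun t j hj => Units.ext (opAt_braid hbr hj)
  have hX : ∀ (X : Matrix (Fin N) (Fin N) A) t j, 1 ≤ j →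
      Commute (opAtUnit t hinv j : Matrix (Fin t → Fin N) (Fin t → Fin N) A) (matAt N t X 0) :=
    fun X t j hj => commute_opAt_matAt (R := toA A R) (fun a b _ _ => hcomm a b _) hj
  refine ⟨fun s t hs hst => ?_, fun s t hs hst => ?_, fun p t i hp hpt hi hip => ?_⟩
  · obtain ⟨s, rfl⟩ := Nat.exists_eq_add_of_le' hs
    have := commute_conjCopy_mul_succ (hfar t) (hbraidA t) (hX M t)
      (fun ht => hM.opAt_matAt ht) (j := s) (by omega)
    simp only [conjCopy_opAtUnit] at this
    exact this.units_inv_left.eq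
  · obtain ⟨s, rfl⟩ := Nat.exists_eq_add_of_le' hs
    have := commute_conjCopy_succ_mul (hfar t) (hbraidA t) (hX D t)
      (fun ht => hD.opAt_matAt ht) (j := s) (by omega)
    simp only [conjCopy_opAtUnit] at this
    exact this.units_inv_left.eq
  · refine (commute_JMup fun j hj => ?_).eq
    have hM' := commute_prod_conjCopy (hfar t) (hbraidA t) (hX M t)
      (fun ht => hM.opAt_matAt ht) (j := j) (by omega) hpt
    have hD' := commute_prod_reverse_conjCopy (hfar t) (hbraidA t) (hX D t)
      (fun ht => hD.opAt_matAt ht) (j := j) (by omega) hpt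
    rw [funext (conjCopy_opAtUnit t hinv M)] at hM'
    rw [funext (conjCopy_opAtUnit t hinv D)] at hD'
    rw [zero_add]
    exact hM'.units_inv_left.mul_right hD'.units_inv_left
end
end

section
/- For every k ≥ 1 the following identity of operators on V^{⊗(k+1)} holds: (I − J_{k+1}⁻¹)/(q − q⁻¹) = R_k⁻¹ + Σ_{s=1}^{k−1} R⁻¹_{k→(s+1)} · R_s⁻¹ · R⁻¹_{(s+1)→k}. In particular, when R tends to the flip P as q → 1, this matrix tends to the sum of transpositions Σ_{i=1}^{k} P_{i,k+1}. -/
open scoped BigOperators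

noncomputable section

/-- The two-site embedding is multiplicative. -/
theorem opAt_mul {α : Type*} [Semiring α] (N k : ℕ)
    (X Y : Matrix (Fin N × Fin N) (Fin N × Fin N) α) {i : ℕ} (h : i + 1 < k) :
    opAt N k X i * opAt N k Y i = opAt N k (X * Y) i := by
  classical
  have hi : i < k := by omega
  have hne : (⟨i, hi⟩ : Fin k) ≠ ⟨i + 1, h⟩ := by simp
  ext a b
  simp only [opAt, dif_pos h, Matrix.mul_apply, Matrix.of_apply]
  let e : Fin N × Fin N → Fin k → Fin N := fun p =>
    Function.update (Function.update a ⟨i, hi⟩ p.1) ⟨i + 1, h⟩ p.2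
  have e_left (p) : e p ⟨i, hi⟩ = p.1 := by simp [e, hne]
  have e_right (p) : e p ⟨i + 1, h⟩ = p.2 := by simp [e]
  have e_other (p) (l : Fin k) (h1 : (l : ℕ) ≠ i) (h2 : (l : ℕ) ≠ i + 1) : e p l = a l := by
    have h1' : l ≠ ⟨i, hi⟩ := fun hl => h1 (congrArg Fin.val hl)
    have h2' : l ≠ ⟨i + 1, h⟩ := fun hl => h2 (congrArg Fin.val hl)
    simp [e, h1', h2']
  symm
  by_cases hab : ∀ l : Fin k, (l : ℕ) ≠ i → (l : ℕ) ≠ i + 1 → a l = b l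
  · rw [if_pos hab]
    refine Finset.sum_of_injOn e ?_ (by simp) ?_ ?_
    · intro p _ p' _ hp
      exact Prod.ext (by rw [← e_left p, hp, e_left]) (by rw [← e_right p, hp, e_right])
    · intro c _ hc
      rw [if_neg, zero_mul]
      intro hac
      refine hc ⟨(c ⟨i, hi⟩, c ⟨i + 1, h⟩), by simp, ?_⟩
      funext l
      by_cases h1 : (l : ℕ) = i
      · obtain rfl : l = ⟨i, hi⟩ := Fin.ext h1
        rw [e_left]
      · by_cases h2 : (l : ℕ) = i + 1
        · obtain rfl : l = ⟨i + 1, h⟩ := Fin.ext h2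
          rw [e_right]
        · rw [e_other _ l h1 h2, hac l h1 h2]
    · intro p _
      rw [if_pos fun l h1 h2 => (e_other p l h1 h2).symm,
        if_pos fun l h1 h2 => (e_other p l h1 h2).trans (hab l h1 h2), e_left, e_right]
  · rw [if_neg hab]
    refine (Finset.sum_eq_zero fun c _ => ?_).symm
    by_cases hac : ∀ l : Fin k, (l : ℕ) ≠ i → (l : ℕ) ≠ i + 1 → a l = c l
    · rw [if_neg (c := ∀ l : Fin k, (l : ℕ) ≠ i → (l : ℕ) ≠ i + 1 → c l = b l), mul_zero]
      exact fun hcb => hab fun l h1 h2 => (hac l h1 h2).trans (hcb l h1 h2)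
    · rw [if_neg hac, zero_mul]

/-- The two-site embedding is unital. -/
theorem opAt_one {α : Type*} [Semiring α] (N k i : ℕ) :
    opAt N k (1 : Matrix (Fin N × Fin N) (Fin N × Fin N) α) i = 1 := by
  unfold opAt
  split_ifs with h
  · ext a b
    rw [Matrix.of_apply, Matrix.one_apply, Matrix.one_apply, ← ite_and]
    congr 1
    rw [Prod.mk.injEq, eq_iff_iff]
    constructor
    · rintro ⟨hab, h1, h2⟩
      funext l
      by_cases hl : (l : ℕ) = i
      · obtain rfl : l = ⟨i, Nat.lt_of_succ_lt h⟩ := Fin.ext hl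
        exact h1
      · by_cases hl' : (l : ℕ) = i + 1
        · obtain rfl : l = ⟨i + 1, h⟩ := Fin.ext hl'
          exact h2
        · exact hab l hl hl'
    · rintro rfl
      simp
  · rfl

/-- The two-site embedding is compatible with subtracting a scalar multiple. -/
theorem opAt_sub_smul (N k : ℕ) (c : ℂ) (X Y : Matrix (Fin N × Fin N) (Fin N × Fin N) ℂ)
    {i : ℕ} (h : i + 1 < k) :
    opAt N k (X - c • Y) i = opAt N k X i - c • opAt N k Y i := by
  ext a b
  simp only [opAt, dif_pos h, Matrix.of_apply, Matrix.sub_apply, Matrix.smul_apply]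
  split_ifs <;> simp

/-- The inverse of a Hecke symmetry satisfies `R⁻² = I − (q − q⁻¹) R⁻¹`. -/
theorem IsHecke.inv_mul_inv {N : ℕ} {q : ℂ} (hq : q ≠ 0)
    {R Rinv : Matrix (Fin N × Fin N) (Fin N × Fin N) ℂ} (hR : Rinv * R = 1) (hR' : R * Rinv = 1)
    (hH : IsHecke N q R) : Rinv * Rinv = 1 - (q - q⁻¹) • Rinv := by
  have hRR : R * R = 1 + (q - q⁻¹) • R := by
    have h := hH
    simp only [IsHecke, sub_mul, mul_add, smul_mul_assoc, mul_smul_comm, one_mul, mul_one,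
      smul_sub, inv_smul_smul₀ hq] at h
    rw [sub_smul]
    refine (sub_eq_zero.mp ?_).symm
    rw [← h]
    abel
  have h1 : Rinv * (R * R) * Rinv = 1 := by
    rw [← mul_assoc, hR, one_mul, hR']
  have h2 : Rinv * Rinv + (q - q⁻¹) • Rinv = 1 := by
    rw [← h1, hRR, mul_add, add_mul, mul_one, mul_smul_comm, hR, smul_mul_assoc, one_mul]
  exact eq_sub_of_add_eq h2

/-- Expansion of the inverse Jucys–Murphy matrices when the embedded operators satisfy a
quadratic relation. -/
theorem one_sub_JMup {N k : ℕ} {c : ℂ} {X : Matrix (Fin N × Fin N) (Fin N × Fin N) ℂ}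
    {n : ℕ} (hX : ∀ i < n + 1, opAt N k X i * opAt N k X i = 1 - c • opAt N k X i) :
    1 - JMup N k X 0 (n + 1) =
      c • (opAt N k X n +
        ∑ s ∈ Finset.Icc 1 n,
          ((List.range' s (n + 1 - s)).reverse.map (opAt N k X)).prod *
            opAt N k X (s - 1) *
            ((List.range' s (n + 1 - s)).map (opAt N k X)).prod) := by
  induction n with
  | zero => simp [JMup, hX 0]
  | succ n ih =>
    have ih' := sub_eq_iff_eq_add'.mp (ih fun i hi => hX i (by omega))
    have hJ : JMup N k X 0 (n + 1) = 1 - c • (opAt N k X n +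
        ∑ s ∈ Finset.Icc 1 n,
          ((List.range' s (n + 1 - s)).reverse.map (opAt N k X)).prod *
            opAt N k X (s - 1) *
            ((List.range' s (n + 1 - s)).map (opAt N k X)).prod) := by
      rw [ih']; abel
    rw [JMup, zero_add, hJ, Finset.sum_Icc_succ_top (by omega), mul_sub, sub_mul, mul_one,
      hX (n + 1) (by omega), mul_smul_comm, smul_mul_assoc, mul_add, add_mul,
      Finset.mul_sum, Finset.sum_mul]
    have hsum : ∀ s ∈ Finset.Icc 1 n,
        opAt N k X (n + 1) * (((List.range' s (n + 1 - s)).reverse.map (opAt N k X)).prod *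
            opAt N k X (s - 1) * ((List.range' s (n + 1 - s)).map (opAt N k X)).prod) *
          opAt N k X (n + 1) =
        ((List.range' s (n + 1 + 1 - s)).reverse.map (opAt N k X)).prod *
            opAt N k X (s - 1) * ((List.range' s (n + 1 + 1 - s)).map (opAt N k X)).prod := by
      intro s hs
      have hs' := (Finset.mem_Icc.mp hs).2
      have hsub : n + 1 + 1 - s = n + 1 - s + 1 := by omega
      have hlast : s + (n + 1 - s) = n + 1 := by omega
      simp [hsub, List.range'_concat, hlast, mul_assoc]
    rw [Finset.sum_congr rfl hsum]
    have hone : n + 1 + 1 - (n + 1) = 1 := by omega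
    simp only [hone, List.range'_one, List.reverse_singleton, List.map_cons, List.map_nil,
      List.prod_singleton, Nat.add_sub_cancel, smul_add]
    abel

/-- For every `k ≥ 1`, on `V^{⊗(k+1)}`:
`(I − J_{k+1}⁻¹)/(q − q⁻¹) = R_k⁻¹ + Σ_{s=1}^{k−1} R⁻¹_{k→(s+1)} R_s⁻¹ R⁻¹_{(s+1)→k}`. -/
theorem stmt18 (N : ℕ) (hN : 1 ≤ N) (q : ℂ)
    (hq : GenericQ q)
    (R Rinv : Matrix (Fin N × Fin N) (Fin N × Fin N) ℂ)
    (hRinv : R * Rinv = 1 ∧ Rinv * R = 1)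
    (hbraid : IsBraid N R) (hHecke : IsHecke N q R)
    (k : ℕ) (hk : 1 ≤ k) :
    (q - q⁻¹)⁻¹ •
        ((1 : Matrix (Fin (k + 1) → Fin N) (Fin (k + 1) → Fin N) ℂ) -
          JMup N (k + 1) Rinv 0 k) =
      opAt N (k + 1) Rinv (k - 1) +
        ∑ s ∈ Finset.Icc 1 (k - 1),
          ((List.range' s (k - s)).reverse.map (opAt N (k + 1) Rinv)).prod *
            opAt N (k + 1) Rinv (s - 1) *
            ((List.range' s (k - s)).map (opAt N (k + 1) Rinv)).prod := by
  obtain ⟨hq0, -, -, hpow⟩ := hq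
  have hc : q - q⁻¹ ≠ 0 := by
    intro h
    apply hpow 2 two_pos
    rw [pow_two]
    nth_rewrite 2 [sub_eq_zero.mp h]
    exact mul_inv_cancel₀ hq0
  obtain ⟨n, rfl⟩ : ∃ n, k = n + 1 := ⟨k - 1, by omega⟩
  have hX : ∀ i < n + 1, opAt N (n + 1 + 1) Rinv i * opAt N (n + 1 + 1) Rinv i =
      1 - (q - q⁻¹) • opAt N (n + 1 + 1) Rinv i := by
    intro i hi
    rw [opAt_mul N _ Rinv Rinv (by omega), hHecke.inv_mul_inv hq0 hRinv.2 hRinv.1,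
      opAt_sub_smul N _ _ _ _ (by omega), opAt_one]
  rw [one_sub_JMup hX, smul_smul, inv_mul_cancel₀ hc, one_smul, Nat.add_sub_cancel]
end
end
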